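/- arXiv:2007.09237 — 3 statements merged into one kernel-verified Lean document; each statement's English description precedes it below -/
import Mathlib

section
/- There exists a first-order formula φ(x) in the language of rings {+,−,·,0,1} with one free variable, of the form ∃∀ (a block of existential quantifiers followed by a block of universal quantifiers applied to a quantifier-free formula), such that for every number field K and every finite place v of K, the set defined by φ in the completion K_v equals the valuation ring 𝒪_v = {x ∈ K_v : |x|_v ≤ 1}. In particular φ defines ℤ_p in ℚ_p for every prime p. -/
open FirstOrder FirstOrder.Language NumberField IsDedekindDomain

attribute [local instance] FirstOrder.Ring.compatibleRingOfRing

noncomputable section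

/-- A bounded formula is a universal block applied to a quantifier-free formula. -/
inductive IsUniversalBlock {L : Language} {α : Type*} :
    {n : ℕ} → L.BoundedFormula α n → Prop
  | of_isQF {n : ℕ} {φ : L.BoundedFormula α n} (h : φ.IsQF) : IsUniversalBlock φ
  | all {n : ℕ} {φ : L.BoundedFormula α (n + 1)} (h : IsUniversalBlock φ) :
      IsUniversalBlock φ.all

/-- A bounded formula is an `∃∀`-formula: a block of existential quantifiers followed by a
block of universal quantifiers applied to a quantifier-free formula. -/
inductive IsExistsForallFormula {L : Language} {α : Type*} :
    {n : ℕ} → L.BoundedFormula α n → Prop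
  | of_universalBlock {n : ℕ} {φ : L.BoundedFormula α n} (h : IsUniversalBlock φ) :
      IsExistsForallFormula φ
  | ex {n : ℕ} {φ : L.BoundedFormula α (n + 1)} (h : IsExistsForallFormula φ) :
      IsExistsForallFormula φ.ex

open WithZero Filter Topology

theorem Valued.nonarchimedeanRing (R : Type*) [Ring R] {Γ₀ : Type*}
    [LinearOrderedCommGroupWithZero Γ₀] [Valued R Γ₀] : NonarchimedeanRing R where
  is_nonarchimedean U hU := by
    obtain ⟨γ, hγ⟩ := Valued.mem_nhds_zero.1 hU
    exact ⟨⟨Valued.v.restrict.ltAddSubgroup γ, Valued.isOpen_ball R γ.1⟩, hγ⟩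

/-- Hensel's lemma for the Artin–Schreier polynomial `Y² + Y - d` over a complete discretely
valued field. -/
theorem Valued.exists_sq_add_self_eq {F : Type*} [Field F] [Valued F ℤᵐ⁰] [CompleteSpace F]
    [T2Space F] {d : F} (hd : Valued.v d < 1) : ∃ y : F, y ^ 2 + y = d := by
  let u : ℕ → F := fun n => (fun y => d - y ^ 2)^[n] 0
  have hu (n : ℕ) : u (n + 1) = d - u n ^ 2 := Function.iterate_succ_apply' _ _ _
  have hd' : Valued.v d ≤ exp (-1 : ℤ) := by
    rw [← lt_mul_exp_iff_le (by simp)]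
    simpa using hd
  have hv (n : ℕ) : Valued.v (u n) ≤ exp (-1 : ℤ) := by
    induction n with
    | zero => simp [u]
    | succ n ih =>
      rw [hu]
      refine (Valued.v.map_sub _ _).trans (max_le hd' ?_)
      rw [map_pow]
      calc Valued.v (u n) ^ 2 ≤ exp (-1 : ℤ) ^ 2 := pow_le_pow_left' ih 2
        _ = exp (-2 : ℤ) := rfl
        _ ≤ exp (-1 : ℤ) := by rw [exp_le_exp]; norm_num
  have hsub (n : ℕ) : Valued.v (u (n + 1) - u n) ≤ exp (-(n : ℤ)) := by
    induction n with
    | zero =>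
      exact (Valued.v.map_sub _ _).trans
        (max_le ((hv _).trans (exp_le_exp.2 (by simp))) ((hv _).trans (exp_le_exp.2 (by simp))))
    | succ n ih =>
      have : u (n + 1 + 1) - u (n + 1) = -((u (n + 1) + u n) * (u (n + 1) - u n)) := by
        rw [hu (n + 1), hu n]; ring
      rw [this, Valuation.map_neg, map_mul]
      calc _ ≤ exp (-1 : ℤ) * exp (-(n : ℤ)) :=
            mul_le_mul' ((Valued.v.map_add _ _).trans (max_le (hv _) (hv _))) ih
        _ = exp (-((n + 1 : ℕ) : ℤ)) := by rw [← exp_add]; congr 1; push_cast; ring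
  have hlim : Tendsto (fun n => u (n + 1) - u n) atTop (𝓝 0) := by
    rw [(Valued.hasBasis_nhds_zero F ℤᵐ⁰).tendsto_right_iff]
    intro γ _
    obtain ⟨N, hN⟩ := exists_exp_neg_natCast_lt
      (x := MonoidWithZeroHom.ValueGroup₀.embedding γ.1) (by simp)
    filter_upwards [eventually_ge_atTop N] with n hn
    have : Valued.v (u (n + 1) - u n) < MonoidWithZeroHom.ValueGroup₀.embedding γ.1 :=
      ((hsub n).trans (exp_le_exp.2 (by simpa using hn))).trans_lt hN
    simpa [Valuation.restrict_lt_iff_lt_embedding] using this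
  have : NonarchimedeanAddGroup F := (Valued.nonarchimedeanRing F).to_nonarchimedeanAddGroup
  obtain ⟨y, hy⟩ := cauchySeq_tendsto_of_complete
    (NonarchimedeanAddGroup.cauchySeq_of_tendsto_sub_nhds_zero hlim)
  refine ⟨y, ?_⟩
  have h1 := (tendsto_add_atTop_iff_nat 1).2 hy
  simp only [hu] at h1
  exact add_eq_of_eq_sub' (tendsto_nhds_unique h1 (tendsto_const_nhds.sub (hy.pow 2)))

/-- Hensel's lemma for the Artin–Schreier polynomial `Y² + Y - d` over `ℚ_p`. -/
theorem Padic.exists_sq_add_self_eq {p : ℕ} [Fact p.Prime] {d : ℚ_[p]} (hd : ‖d‖ < 1) :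
    ∃ y : ℚ_[p], y ^ 2 + y = d := by
  obtain ⟨e, rfl⟩ : ∃ e : ℤ_[p], (e : ℚ_[p]) = d := ⟨⟨d, hd.le⟩, rfl⟩
  let P : Polynomial ℤ_[p] := .X ^ 2 + .X - .C e
  have hP (a : ℤ_[p]) : P.aeval a = a ^ 2 + a - e := by simp [P]
  have hP' : P.derivative.aeval (0 : ℤ_[p]) = 1 := by simp [P]
  obtain ⟨z, hz, -⟩ := hensels_lemma (F := P) (a := 0)
    (by rw [hP, hP']; simpa using hd)
  rw [hP, sub_eq_zero] at hz
  exact ⟨z, by exact_mod_cast congrArg ((↑) : ℤ_[p] → ℚ_[p]) hz⟩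

theorem Padic.mulValuation_le_one_iff {p : ℕ} [Fact p.Prime] {x : ℚ_[p]} :
    Padic.mulValuation x ≤ 1 ↔ ‖x‖ ≤ 1 := by
  rcases eq_or_ne x 0 with rfl | hx
  · simp
  · have := (Fact.out : p.Prime).one_lt
    rw [Padic.norm_eq_zpow_log_mulValuation hx, zpow_le_one_iff_right₀ (by exact_mod_cast this),
      log_le_iff_le_exp (by simpa using hx), exp_zero]

theorem Padic.mulValuation_lt_one_iff {p : ℕ} [Fact p.Prime] {x : ℚ_[p]} :
    Padic.mulValuation x < 1 ↔ ‖x‖ < 1 := by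
  rcases eq_or_ne x 0 with rfl | hx
  · simp
  · have := (Fact.out : p.Prime).one_lt
    rw [Padic.norm_eq_zpow_log_mulValuation hx, zpow_lt_one_iff_right₀ (by exact_mod_cast this),
      log_lt_iff_lt_exp (by simpa using hx), exp_zero]

theorem Valuation.even_log_sq_add_self {F : Type*} [Field F] (v : Valuation F ℤᵐ⁰) {y : F}
    (hy : 0 < log (v (y ^ 2 + y))) : Even (log (v (y ^ 2 + y))) := by
  rcases le_or_gt (v y) 1 with h | h
  · have h1 : v (y ^ 2 + y) ≤ 1 := by
      refine (v.map_add _ _).trans (max_le ?_ h)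
      rw [map_pow]
      exact pow_le_one' h 2
    have h0 : v (y ^ 2 + y) ≠ 0 := by rintro h; simp [h] at hy
    rw [lt_log_iff_exp_lt h0, exp_zero] at hy
    exact absurd hy h1.not_gt
  · have h0 : v y ≠ 0 := (zero_lt_one.trans h).ne'
    rw [Valuation.map_add_eq_of_lt_left, map_pow, log_pow]
    · simp
    · rw [map_pow, pow_two]
      exact lt_mul_of_one_lt_left (zero_lt_iff.2 h0) h

/-- In a discretely valued field in which `Y² + Y - d` has a root for every `d` of positive
valuation, the valuation ring is the union of the sets `{x | t x² ∈ ℘(F)}`, where `℘ y = y² + y` and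
`t ≠ 0` runs over the parameters such that `(t a⁶)⁻¹ ∉ ℘(F)` whenever `t a² ∈ ℘(F)`. -/
theorem Valuation.le_one_iff_exists_forall {F : Type*} [Field F] (v : Valuation F ℤᵐ⁰)
    (hπ : ∃ π, v π = exp (-1)) (hensel : ∀ d, v d < 1 → ∃ y, y ^ 2 + y = d) (x : F) :
    v x ≤ 1 ↔ ∃ t y : F, ∀ a b c : F, t ≠ 0 ∧ y ^ 2 + y = t * x ^ 2 ∧
      (b ^ 2 + b = t * a ^ 2 → (c ^ 2 + c) * (t * a ^ 6) ≠ 1) := by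
  constructor
  · intro hx
    obtain ⟨π, hπ⟩ := hπ
    have hπ0 : π ≠ 0 := v.ne_zero_iff.1 (by simp [hπ])
    obtain ⟨y, hy⟩ := hensel (π * x ^ 2) <| by
      rw [map_mul, map_pow, hπ]
      exact (mul_le_of_le_one_right' (pow_le_one' hx 2)).trans_lt
        (by rw [← exp_zero, exp_lt_exp]; norm_num)
    refine ⟨π, y, fun a b c => ⟨hπ0, hy, fun hb hc => ?_⟩⟩
    have ha0 : a ≠ 0 := by rintro rfl; simp at hc
    have hlog : log (v (b ^ 2 + b)) = -1 + 2 * log (v a) := by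
      rw [hb, map_mul, map_pow, log_mul (by simp [hπ]) (by simp [ha0]), log_pow, hπ, log_exp]
      simp
    have hlog' : log (v (c ^ 2 + c)) = 1 - 6 * log (v a) := by
      rw [eq_inv_of_mul_eq_one_left hc, map_inv₀, map_mul, map_pow, log_inv,
        log_mul (by simp [hπ]) (by simp [ha0]), log_pow, hπ, log_exp]
      simp
      ring
    have hb' := v.even_log_sq_add_self (y := b)
    have hc' := v.even_log_sq_add_self (y := c)
    grind
  · rintro ⟨t, y, h⟩
    have ht : t ≠ 0 := (h 0 0 0).1
    have hy := (h 0 0 0).2.1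
    replace h a b c := (h a b c).2.2
    have hvt : v t ≠ 0 := v.ne_zero_iff.2 ht
    have key (a b : F) (ha : a ≠ 0) (hb : b ^ 2 + b = t * a ^ 2) :
        log (v t) + 6 * log (v a) ≤ 0 := by
      by_contra! hlt
      have h0 : t * a ^ 6 ≠ 0 := mul_ne_zero ht (pow_ne_zero 6 ha)
      obtain ⟨c, hc⟩ := hensel (t * a ^ 6)⁻¹ <| by
        rw [← exp_zero, ← log_lt_iff_lt_exp (v.ne_zero_iff.2 (inv_ne_zero h0)), map_inv₀,
          log_inv, map_mul, map_pow, log_mul hvt (by simp [ha]), log_pow, nsmul_eq_mul]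
        push_cast
        lia
      exact h a b c hb (by rw [hc, inv_mul_cancel₀ h0])
    by_contra! hx
    have hx0 : x ≠ 0 := by rintro rfl; simp at hx
    have hvx : v x ≠ 0 := v.ne_zero_iff.2 hx0
    have hlx : 0 < log (v x) := by rwa [lt_log_iff_exp_lt hvx, exp_zero]
    have h1 := key x y hx0 hy
    obtain ⟨π, hπ⟩ := hπ
    have hπ0 : π ≠ 0 := v.ne_zero_iff.1 (by simp [hπ])
    have hv2 (m : ℤ) : log (v (π ^ m)) = -m := by
      rw [map_zpow₀, log_zpow, hπ, log_exp]; simp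
    set n := -log (v t) with hn
    let a : F := π ^ (-((n - 1) / 2))
    have ha0 : a ≠ 0 := zpow_ne_zero _ hπ0
    have hla : log (v a) = (n - 1) / 2 := by simp only [a, hv2, neg_neg]
    obtain ⟨b, hb⟩ := hensel (t * a ^ 2) <| by
      rw [← exp_zero, ← log_lt_iff_lt_exp (by simp [ht, ha0]), map_mul, map_pow,
        log_mul hvt (by simp [ha0]), log_pow, hla, nsmul_eq_mul]
      push_cast
      omega
    have h2 := key a b ha0 hb
    omega

/-- The quantifier-free matrix of the formula defining the valuation ring. -/
def valuationRingMatrix : Language.ring.BoundedFormula (Fin 1) 5 :=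
  let x : Language.ring.Term (Fin 1 ⊕ Fin 5) := Term.var (Sum.inl 0)
  let t : Language.ring.Term (Fin 1 ⊕ Fin 5) := &0
  let y : Language.ring.Term (Fin 1 ⊕ Fin 5) := &1
  let a : Language.ring.Term (Fin 1 ⊕ Fin 5) := &2
  let b : Language.ring.Term (Fin 1 ⊕ Fin 5) := &3
  let c : Language.ring.Term (Fin 1 ⊕ Fin 5) := &4
  ∼(t =' 0) ⊓ (((y * y + y) =' (t * (x * x))) ⊓
    (((b * b + b) =' (t * (a * a))) ⟹
      ∼(((c * c + c) * (t * (a * a * (a * a) * (a * a)))) =' 1)))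

/-- An `∃∀`-formula defining the valuation ring of a complete discretely valued field. -/
def valuationRingFormula : Language.ring.Formula (Fin 1) := ∃' ∃' ∀' ∀' ∀' valuationRingMatrix

theorem isExistsForallFormula_valuationRingFormula :
    IsExistsForallFormula valuationRingFormula := by
  have h : valuationRingMatrix.IsQF := by
    refine .inf (.not ?_) (.inf ?_ (.imp ?_ (.not ?_))) <;>
      exact (BoundedFormula.IsAtomic.equal _ _).isQF
  exact .ex <| .ex <| .of_universalBlock <| .all <| .all <| .all <| .of_isQF h

theorem realize_valuationRingFormula {F : Type*} [Field F] (x : F) :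
    valuationRingFormula.Realize (fun _ => x) ↔
      ∃ t y : F, ∀ a b c : F, t ≠ 0 ∧ y ^ 2 + y = t * x ^ 2 ∧
        (b ^ 2 + b = t * a ^ 2 → (c ^ 2 + c) * (t * a ^ 6) ≠ 1) := by
  simp only [valuationRingFormula, Formula.Realize, BoundedFormula.realize_ex,
    BoundedFormula.realize_all]
  refine exists_congr fun t => exists_congr fun y => forall_congr' fun a => forall_congr' fun b =>
    forall_congr' fun c => ?_
  simp [valuationRingMatrix, Fin.snoc, pow_succ, mul_assoc]

/-- There is a single `∃∀`-formula `φ(x)` of the language of rings which,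
for every number field `K` and every finite place `v` of `K`, defines in the completion
`K_v` exactly the valuation ring `𝒪_v = {x : |x|ᵥ ≤ 1}`; in particular `φ` defines `ℤ_p`
in `ℚ_p` for every prime `p`. -/
theorem exists_existsForall_formula_defining_valuation_rings :
    ∃ φ : Language.ring.Formula (Fin 1),
      IsExistsForallFormula φ ∧
      (∀ (K : Type) [Field K] [NumberField K], ∀ v : HeightOneSpectrum (𝓞 K),
        ∀ x : v.adicCompletion K,
          (φ.Realize (fun _ => x) ↔ Valued.v x ≤ 1)) ∧
      (∀ (p : ℕ) [Fact p.Prime], ∀ x : ℚ_[p],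
        (φ.Realize (fun _ => x) ↔ ‖x‖ ≤ 1)) := by
  refine ⟨valuationRingFormula, isExistsForallFormula_valuationRingFormula,
    fun K _ _ v x => ?_, fun p _ x => ?_⟩
  · rw [realize_valuationRingFormula]
    exact (Valued.v.le_one_iff_exists_forall (v.valuedAdicCompletion_surjective K _)
      (fun _ => Valued.exists_sq_add_self_eq) x).symm
  · rw [realize_valuationRingFormula, ← Padic.mulValuation_le_one_iff]
    refine (Padic.mulValuation.le_one_iff_exists_forall ⟨p, ?_⟩ (fun d hd => ?_) x).symm
    · simp [(Fact.out : p.Prime).ne_zero]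
    · exact Padic.exists_sq_add_self_eq (Padic.mulValuation_lt_one_iff.1 hd)
end
end

section
/- There is no existential formula φ(x) in the language of rings (a block of existential quantifiers applied to a quantifier-free formula, one free variable) such that for all but finitely many primes p the set defined by φ in ℚ_p equals ℤ_p; likewise there is no universal formula (a block of universal quantifiers applied to a quantifier-free formula) with this property. -/
open FirstOrder FirstOrder.Language

attribute [local instance] FirstOrder.Ring.compatibleRingOfRing

noncomputable section

/-- A bounded formula is an existential formula: a block of existential quantifiers
applied to a quantifier-free formula. -/
inductive IsExistentialBlock {L : Language} {α : Type*} :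
    {n : ℕ} → L.BoundedFormula α n → Prop
  | of_isQF {n : ℕ} {φ : L.BoundedFormula α n} (h : φ.IsQF) : IsExistentialBlock φ
  | ex {n : ℕ} {φ : L.BoundedFormula α (n + 1)} (h : IsExistentialBlock φ) :
      IsExistentialBlock φ.ex

/-- `φ` defines the valuation ring `ℤ_p` in `ℚ_p`. -/
def DefinesZp (φ : Language.ring.Formula (Fin 1)) (p : ℕ) : Prop :=
  ∀ (_ : Fact p.Prime), ∀ x : ℚ_[p], (φ.Realize (fun _ => x) ↔ ‖x‖ ≤ 1)

section

open Polynomial Filter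

/-- A nonconstant integer polynomial has a root modulo some prime not dividing a given
nonzero integer. -/
theorem Int.exists_prime_dvd_eval {h : ℤ[X]} (hh : 0 < h.natDegree) {M : ℤ} (hM : M ≠ 0) :
    ∃ p : ℕ, p.Prime ∧ ¬ (p : ℤ) ∣ M ∧ ∃ y : ℤ, (p : ℤ) ∣ h.eval y := by
  by_cases h0 : h.eval 0 = 0
  · obtain ⟨p, hp, hpp⟩ := Nat.exists_infinite_primes (M.natAbs + 1)
    refine ⟨p, hpp, fun hd => ?_, 0, by simp [h0]⟩
    have := Nat.le_of_dvd (Int.natAbs_pos.2 hM) (Int.natCast_dvd.1 hd)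
    omega
  · set c := h.eval 0 with hc
    have hMc : M * c ≠ 0 := mul_ne_zero hM h0
    -- the values `h (M c m)` are `c` times integers congruent to `1` modulo `M`
    have key : ∀ m : ℤ, ∃ u : ℤ, h.eval (M * c * m) = c * (1 + M * u) := fun m => by
      obtain ⟨k, hk⟩ := sub_dvd_eval_sub (M * c * m) 0 h
      exact ⟨m * k, by linear_combination hk⟩
    have hfin : {m : ℤ | h.eval (M * c * m) ∈ ({c, -c} : Set ℤ)}.Finite := by
      have hinj : Function.Injective fun m : ℤ => M * c * m := mul_right_injective₀ hMc
      refine Set.Finite.preimage (f := fun m : ℤ => M * c * m) hinj.injOn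
        (s := {x | h.eval x ∈ ({c, -c} : Set ℤ)}) ?_
      have : {x | h.eval x ∈ ({c, -c} : Set ℤ)} =
          {x | (h - C c).IsRoot x} ∪ {x | (h - C (-c)).IsRoot x} := by
        ext x; simp [sub_eq_zero, ← add_eq_zero_iff_eq_neg]
      rw [this]
      have hne : ∀ a : ℤ, h - C a ≠ 0 := fun a ha => by
        rw [sub_eq_zero.1 ha] at hh; simp at hh
      exact (finite_setOfPred_isRoot (hne _)).union (finite_setOfPred_isRoot (hne _))
    obtain ⟨m, hm⟩ := hfin.infinite_compl.nonempty
    obtain ⟨u, hu⟩ := key m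
    have hunit : (1 + M * u).natAbs ≠ 1 := fun h1 => hm <| by
      rcases Int.natAbs_eq_iff.1 h1 with h1 | h1 <;> simp [hu, h1]
    obtain ⟨p, hp, hpd⟩ := Nat.exists_prime_and_dvd hunit
    have hpd' : (p : ℤ) ∣ 1 + M * u := Int.natCast_dvd.2 hpd
    refine ⟨p, hp, fun hd => ?_, M * c * m, hu ▸ hpd'.mul_left c⟩
    have : (p : ℤ) ∣ 1 := (Int.dvd_add_left (hd.mul_right u)).1 hpd'
    exact hp.one_lt.ne' (by exact_mod_cast Int.eq_one_of_dvd_one (by positivity) this)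

/-- Every nonzero integer polynomial splits, and stays nonzero, modulo some prime. -/
theorem Polynomial.exists_prime_splits_zmod {G : ℤ[X]} (hG : G ≠ 0) :
    ∃ p : ℕ, p.Prime ∧ G.map (Int.castRingHom (ZMod p)) ≠ 0 ∧
      (G.map (Int.castRingHom (ZMod p))).Splits := by
  obtain ⟨L, _, _, _, hGL⟩ : ∃ (L : Type) (_ : Field L) (_ : Algebra ℚ L),
      FiniteDimensional ℚ L ∧ ((G.map (Int.castRingHom ℚ)).map (algebraMap ℚ L)).Splits :=
    ⟨SplittingField (G.map (Int.castRingHom ℚ)), inferInstance, inferInstance, inferInstance,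
      SplittingField.splits _⟩
  have : CharZero L := algebraRat.charZero L
  have hLalg : Algebra.IsAlgebraic ℤ L :=
    (IsFractionRing.comap_isAlgebraic_iff (A := ℤ) (K := ℚ) (C := L)).2 inferInstance
  obtain ⟨θ₀, hθ₀⟩ := Field.exists_primitive_element ℚ L
  obtain ⟨m, hm, hθ⟩ := (hLalg.isAlgebraic θ₀).exists_integral_multiple
  set θ := m • θ₀ with hθdef
  have hθtop : Algebra.adjoin ℚ {θ} = ⊤ := by
    have h1 : IntermediateField.adjoin ℚ {θ} = ⊤ := by
      rw [eq_top_iff, ← hθ₀, IntermediateField.adjoin_simple_le_iff]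
      have : θ₀ = (m : ℚ)⁻¹ • θ := by
        rw [hθdef, ← Int.cast_smul_eq_zsmul ℚ, smul_smul, inv_mul_cancel₀ (by exact_mod_cast hm),
          one_smul]
      rw [this]
      exact IntermediateField.smul_mem _ (IntermediateField.mem_adjoin_simple_self _ _)
    rw [← IntermediateField.adjoin_simple_toSubalgebra_of_isAlgebraic
      (Algebra.IsAlgebraic.isAlgebraic θ), h1, IntermediateField.top_toSubalgebra]
  let S := Algebra.adjoin ℤ {θ}
  -- every element of `L` has a nonzero integer multiple in `ℤ[θ]`
  have hden : ∀ x : L, ∃ d : ℤ, d ≠ 0 ∧ d * x ∈ S := fun x => by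
    have hx : x ∈ Algebra.adjoin ℚ {θ} := hθtop ▸ Algebra.mem_top
    induction hx using Algebra.adjoin_induction with
    | mem x hx => exact ⟨1, one_ne_zero, by simpa using! Algebra.subset_adjoin hx⟩
    | algebraMap q =>
      refine ⟨q.den, by simp, ?_⟩
      have : ((q.den : ℤ) : L) * algebraMap ℚ L q = (q.num : ℤ) := by
        rw [← map_intCast (algebraMap ℚ L), ← map_intCast (algebraMap ℚ L), ← map_mul]
        simp [Rat.den_mul_eq_num]
      rw [this]
      exact intCast_mem S _
    | add x y _ _ hx hy =>
      obtain ⟨d, hd, hx⟩ := hx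
      obtain ⟨e, he, hy⟩ := hy
      refine ⟨d * e, mul_ne_zero hd he, ?_⟩
      have : ((d * e : ℤ) : L) * (x + y) = (e : L) * (d * x) + d * (e * y) := by push_cast; ring
      rw [this]
      exact add_mem (mul_mem (intCast_mem S _) hx) (mul_mem (intCast_mem S _) hy)
    | mul x y _ _ hx hy =>
      obtain ⟨d, hd, hx⟩ := hx
      obtain ⟨e, he, hy⟩ := hy
      refine ⟨d * e, mul_ne_zero hd he, ?_⟩
      have : ((d * e : ℤ) : L) * (x * y) = (d * x) * (e * y) := by push_cast; ring
      rw [this]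
      exact mul_mem hx hy
  have hprod : ∀ s : Multiset L, ∃ D : ℤ, D ≠ 0 ∧ ∃ P : S[X],
      P.map (algebraMap S L) = C (D : L) * (s.map fun r => X - C r).prod ∧
      ∀ (F : Type) [Field F] (φ : S →+* F), (P.map φ).Splits := fun s => by
    induction s using Multiset.induction with
    | empty => exact ⟨1, one_ne_zero, 1, by simp, fun F _ φ => by simp⟩
    | cons r s ih =>
      obtain ⟨D, hD, P, hP, hs⟩ := ih
      obtain ⟨d, hd, hr⟩ := hden r
      refine ⟨d * D, mul_ne_zero hd hD, (C (d : S) * X - C ⟨_, hr⟩) * P, ?_, fun F _ φ => ?_⟩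
      · have hr' : algebraMap S L ⟨_, hr⟩ = d * r := rfl
        rw [Polynomial.map_mul, hP, Polynomial.map_sub, Polynomial.map_mul, map_C, map_C, map_X,
          hr', map_intCast, Multiset.map_cons, Multiset.prod_cons]
        push_cast [map_mul]
        ring
      · rw [Polynomial.map_mul]
        refine Splits.mul (Splits.of_natDegree_le_one ?_) (hs F φ)
        simp only [Polynomial.map_sub, Polynomial.map_mul, map_C, map_X]
        compute_degree
  obtain ⟨D, hD, P, hP, hsplit⟩ := hprod ((G.map (Int.castRingHom ℚ)).map (algebraMap ℚ L)).roots
  have hid : C (D : S) * G.map (Int.castRingHom S) = C (G.leadingCoeff : S) * P := by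
    apply Polynomial.map_injective (algebraMap S L) Subtype.val_injective
    have h1 := hGL.eq_prod_roots
    rw [leadingCoeff_map, leadingCoeff_map_of_injective (RingHom.injective_int _)] at h1
    rw [Polynomial.map_mul, Polynomial.map_mul, hP, map_C, map_C, map_intCast (algebraMap S L),
      map_intCast (algebraMap S L), Polynomial.map_map]
    have h2 : (algebraMap S L).comp (Int.castRingHom S) =
      (algebraMap ℚ L).comp (Int.castRingHom ℚ) := RingHom.ext_int _ _
    rw [h2, ← Polynomial.map_map]
    conv_lhs => rw [h1]
    rw [eq_intCast, map_intCast (algebraMap ℚ L)]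
    ring
  obtain ⟨p, hp, hpM, y, hy⟩ := Int.exists_prime_dvd_eval (minpoly.natDegree_pos hθ)
    (mul_ne_zero hD (leadingCoeff_ne_zero.2 hG))
  have := Fact.mk hp
  have hy' : (minpoly ℤ θ).eval₂ (Int.castRingHom (ZMod p)) (y : ZMod p) = 0 := by
    rw [← eq_intCast (Int.castRingHom (ZMod p)) y, eval₂_at_apply, eq_intCast,
      ZMod.intCast_zmod_eq_zero_iff_dvd]
    exact hy
  let φ : S →+* ZMod p := (AdjoinRoot.lift (Int.castRingHom (ZMod p)) (y : ZMod p) hy').comp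
    (minpoly.equivAdjoin hθ).symm.toRingEquiv.toRingHom
  have hpD : (D : ZMod p) ≠ 0 := fun h =>
    hpM (((ZMod.intCast_zmod_eq_zero_iff_dvd _ _).1 h).mul_right _)
  have hpa : (G.leadingCoeff : ZMod p) ≠ 0 := fun h =>
    hpM (((ZMod.intCast_zmod_eq_zero_iff_dvd _ _).1 h).mul_left _)
  refine ⟨p, hp, fun h => hpa ?_, ?_⟩
  · simpa using congrArg (fun q => q.coeff G.natDegree) h
  · have h1 := congrArg (Polynomial.map φ) hid
    rw [Polynomial.map_mul, Polynomial.map_mul, map_C, map_C, map_intCast φ, map_intCast φ,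
      Polynomial.map_map,
      (RingHom.ext_int _ _ : φ.comp (Int.castRingHom S) = Int.castRingHom (ZMod p))] at h1
    have h2 : G.map (Int.castRingHom (ZMod p)) =
        C (D : ZMod p)⁻¹ * (C (G.leadingCoeff : ZMod p) * P.map φ) := by
      rw [← h1, ← mul_assoc, ← C_mul, inv_mul_cancel₀ hpD, C_1, one_mul]
    rw [h2]
    exact ((hsplit _ φ).C_mul _).C_mul _

namespace FirstOrder.Ring

/-- A ring homomorphism is a homomorphism in the language of rings. -/
def languageHomOfRingHom {R S : Type*} [NonAssocRing R] [NonAssocRing S]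
    [CompatibleRing R] [CompatibleRing S] (f : R →+* S) : Language.ring.Hom R S where
  toFun := f
  map_fun' g _ := by cases g <;> simp
  map_rel' g := by cases g

/-- An injective ring homomorphism is an embedding in the language of rings. -/
def languageEmbeddingOfRingHom {R S : Type*} [NonAssocRing R] [NonAssocRing S]
    [CompatibleRing R] [CompatibleRing S] (f : R →+* S) (hf : Function.Injective f) :
    Language.ring.Embedding R S where
  toFun := f
  inj' := hf
  map_fun' g _ := by cases g <;> simp
  map_rel' g := by cases g

end FirstOrder.Ring

/-- The negation of a universal formula is equivalent to an existential one. -/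
theorem IsUniversalBlock.exists_existential_not {L : Language} {α : Type*} {n : ℕ}
    {φ : L.BoundedFormula α n} (hφ : IsUniversalBlock φ) :
    ∃ ψ : L.BoundedFormula α n, IsExistentialBlock ψ ∧
      ∀ (M : Type) [L.Structure M] (v : α → M) (xs : Fin n → M),
        ψ.Realize v xs ↔ ¬ φ.Realize v xs := by
  induction hφ with
  | of_isQF h => exact ⟨_, .of_isQF h.not, fun M _ v xs => BoundedFormula.realize_not⟩
  | all _ ih =>
    obtain ⟨ψ, hψ, h⟩ := ih
    exact ⟨ψ.ex, hψ.ex, fun M _ v xs => by simp [h]⟩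

/-- The truth value of a quantifier-free formula at a tuple over an extension ring is shared
by all tuples satisfying the same algebraic relations, away from a suitable hypersurface. -/
theorem FirstOrder.Language.BoundedFormula.IsQF.exists_mvPolynomial {Ω B : Type*} [Field Ω]
    [Field B] [Algebra Ω B] {α : Type*} {n : ℕ} {φ : Language.ring.BoundedFormula α n}
    (hφ : φ.IsQF) (v : α → Ω) (xs : Fin n → B) :
    ∃ q : MvPolynomial (Fin n) Ω, MvPolynomial.aeval xs q ≠ 0 ∧
      ∀ xs' : Fin n → Ω, (∀ P : MvPolynomial (Fin n) Ω,
        MvPolynomial.aeval xs P = 0 → MvPolynomial.eval xs' P = 0) →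
        MvPolynomial.eval xs' q ≠ 0 →
        (φ.Realize v xs' ↔ φ.Realize (algebraMap Ω B ∘ v) xs) := by
  induction hφ with
  | falsum => exact ⟨1, by simp, fun _ _ _ => Iff.rfl⟩
  | of_isAtomic h =>
    cases h with
    | rel R => cases R
    | equal t₁ t₂ =>
      let poly (t : Language.ring.Term (α ⊕ Fin n)) : MvPolynomial (Fin n) Ω :=
        t.realize (Sum.elim (MvPolynomial.C ∘ v) MvPolynomial.X)
      have hB (t : Language.ring.Term (α ⊕ Fin n)) :
          MvPolynomial.aeval xs (poly t) = t.realize (Sum.elim (algebraMap Ω B ∘ v) xs) := by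
        refine (HomClass.realize_term (Ring.languageHomOfRingHom
          (MvPolynomial.aeval (R := Ω) xs).toRingHom)).symm.trans ?_
        congr 1
        ext (i | i)
        · exact MvPolynomial.aeval_C _ _
        · exact MvPolynomial.aeval_X _ _
      have hΩ (xs' : Fin n → Ω) (t : Language.ring.Term (α ⊕ Fin n)) :
          MvPolynomial.eval xs' (poly t) = t.realize (Sum.elim v xs') := by
        refine (HomClass.realize_term (Ring.languageHomOfRingHom
          (MvPolynomial.eval xs'))).symm.trans ?_
        congr 1
        ext (i | i)
        · exact MvPolynomial.eval_C _
        · exact MvPolynomial.eval_X _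
      simp only [BoundedFormula.realize_bdEqual, ← hB, ← hΩ]
      by_cases h0 : MvPolynomial.aeval xs (poly t₁ - poly t₂) = 0
      · refine ⟨1, by simp, fun xs' h _ => iff_of_true ?_ ?_⟩
        · simpa [sub_eq_zero] using h _ h0
        · simpa [sub_eq_zero] using h0
      · refine ⟨poly t₁ - poly t₂, h0, fun xs' h hq => iff_of_false ?_ ?_⟩
        · simpa [sub_eq_zero] using hq
        · simpa [sub_eq_zero] using h0
  | imp _ _ ih₁ ih₂ =>
    obtain ⟨q₁, hq₁, h₁⟩ := ih₁
    obtain ⟨q₂, hq₂, h₂⟩ := ih₂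
    refine ⟨q₁ * q₂, by simp [hq₁, hq₂], fun xs' h hq => ?_⟩
    rw [map_mul] at hq
    rw [BoundedFormula.realize_imp, BoundedFormula.realize_imp,
      h₁ xs' h (left_ne_zero_of_mul hq), h₂ xs' h (right_ne_zero_of_mul hq)]

/-- Existential formulas true in an extension of an algebraically closed field
already have witnesses in that field. -/
theorem IsExistentialBlock.exists_realize_of_isAlgClosed {Ω B : Type*} [Field Ω]
    [IsAlgClosed Ω] [Field B] [Algebra Ω B] {α : Type*} {n : ℕ}
    {φ : Language.ring.BoundedFormula α n} (hφ : IsExistentialBlock φ) (v : α → Ω)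
    {xs : Fin n → B} (h : φ.Realize (algebraMap Ω B ∘ v) xs) :
    ∃ xs' : Fin n → Ω, φ.Realize v xs' := by
  induction hφ with
  | of_isQF hφ =>
    obtain ⟨q, hq, hreal⟩ := hφ.exists_mvPolynomial v xs
    let I := RingHom.ker (MvPolynomial.aeval (R := Ω) xs)
    have : I.IsPrime := RingHom.ker_isPrime _
    have hqI : q ∉ MvPolynomial.vanishingIdeal Ω (MvPolynomial.zeroLocus Ω I) := by
      rw [MvPolynomial.IsPrime.vanishingIdeal_zeroLocus]
      exact hq
    simp only [MvPolynomial.mem_vanishingIdeal_iff, not_forall] at hqI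
    obtain ⟨xs', hxs', hq'⟩ := hqI
    exact ⟨xs', (hreal xs' (fun P hP => by simpa using hxs' P hP) (by simpa using hq')).2 h⟩
  | ex _ ih =>
    obtain ⟨b, hb⟩ := BoundedFormula.realize_ex.1 h
    obtain ⟨xs', h'⟩ := ih hb
    refine ⟨Fin.init xs', BoundedFormula.realize_ex.2 ⟨xs' (Fin.last _), ?_⟩⟩
    rwa [Fin.snoc_init_self]

namespace PadicAlgCl

variable {p : ℕ} [Fact p.Prime]

theorem norm_algebraMap (x : ℚ_[p]) : ‖algebraMap ℚ_[p] (PadicAlgCl p) x‖ = ‖x‖ :=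
  norm_extends p x

theorem norm_intCast (k : ℤ) : ‖(k : PadicAlgCl p)‖ = ‖(k : ℚ_[p])‖ := by
  rw [← norm_algebraMap, map_intCast]

theorem norm_intCast_le_one (k : ℤ) : ‖(k : PadicAlgCl p)‖ ≤ 1 :=
  (norm_intCast k).trans_le (Padic.norm_int_le_one k)

theorem norm_intCast_eq_one {k : ℤ} (hk : ¬ (p : ℤ) ∣ k) : ‖(k : PadicAlgCl p)‖ = 1 :=
  (norm_intCast_le_one k).antisymm <| not_lt.1 fun h =>
    hk (Padic.norm_intCast_lt_one_iff.1 (norm_intCast (p := p) k ▸ h))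

theorem norm_natCast_eq_one {n : ℕ} (h0 : n ≠ 0) (hn : n < p) : ‖(n : PadicAlgCl p)‖ = 1 := by
  rw [← Int.cast_natCast]
  exact norm_intCast_eq_one fun h =>
    hn.not_ge (Nat.le_of_dvd h0.bot_lt (Int.natCast_dvd_natCast.1 h))

theorem norm_eq_of_norm_sub_lt_right {x y : PadicAlgCl p} (h : ‖x - y‖ < ‖y‖) : ‖x‖ = ‖y‖ := by
  have : ‖x + -y‖ < max ‖x‖ ‖-y‖ := lt_max_of_lt_right (by rwa [← sub_eq_add_neg, norm_neg])
  rw [IsUltrametricDist.norm_eq_of_add_norm_lt_max this, norm_neg]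

/-- Galois automorphisms are isometries. -/
theorem norm_algEquiv (σ : PadicAlgCl p ≃ₐ[ℚ_[p] ] PadicAlgCl p) (x : PadicAlgCl p) :
    ‖σ x‖ = ‖x‖ :=
  (spectralNorm_eq_of_equiv σ x).symm

theorem norm_multiset_sum_lt {ι : Type*} {b : ℝ} (hb : 0 < b) (s : Multiset ι)
    (f : ι → PadicAlgCl p) (h : ∀ r ∈ s, ‖f r‖ < b) : ‖(s.map f).sum‖ < b := by
  induction s using Multiset.induction with
  | empty => simpa
  | cons a s ih =>
    rw [Multiset.map_cons, Multiset.sum_cons]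
    exact (isNonarchimedean p _ _).trans_lt (max_lt (h a (by simp))
      (ih fun r hr => h r (Multiset.mem_cons_of_mem hr)))

/-- An element of degree less than `p` over `ℚ_[p]` lies in `ℚ_[p]` as soon as its difference
with the average of its conjugates is approximated by an element of `ℚ_[p]`. -/
theorem mem_range_of_norm_sub_lt {x : PadicAlgCl p}
    {s : Multiset (PadicAlgCl p)} (hs : s = (minpoly ℚ_[p] x).aroots (PadicAlgCl p))
    (hp : s.card < p)
    (h : x - s.sum / s.card ≠ 0 → ∃ d : ℚ_[p],
      ‖x - s.sum / s.card - algebraMap _ _ d‖ < ‖x - s.sum / s.card‖) :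
    x ∈ (algebraMap ℚ_[p] (PadicAlgCl p)).range := by
  have hx : IsIntegral ℚ_[p] x := Algebra.IsIntegral.isIntegral x
  have hsplit : ((minpoly ℚ_[p] x).map (algebraMap _ (PadicAlgCl p))).Splits :=
    IsAlgClosed.splits _
  have hsum : ∃ c : ℚ_[p], algebraMap _ _ c = s.sum / s.card := by
    have := hsplit.nextCoeff_eq_neg_sum_roots_of_monic ((minpoly.monic hx).map _)
    rw [nextCoeff_map (algebraMap ℚ_[p] (PadicAlgCl p)).injective] at this
    exact ⟨-(minpoly ℚ_[p] x).nextCoeff / s.card, by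
      rw [map_div₀, map_neg, this, neg_neg, map_natCast, hs]⟩
  obtain ⟨c, hc⟩ := hsum
  have hcard : s.card ≠ 0 := by
    have h1 := hsplit.natDegree_eq_card_roots
    rw [natDegree_map] at h1
    rw [hs, aroots, ← h1]
    exact (minpoly.natDegree_pos hx).ne'
  rw [← hc] at h
  by_cases h0 : x - algebraMap _ _ c = 0
  · exact ⟨c, (sub_eq_zero.1 h0).symm⟩
  obtain ⟨d, hd⟩ := h h0
  exfalso
  set y := x - algebraMap _ _ c
  have hnd : ‖algebraMap _ (PadicAlgCl p) d‖ = ‖y‖ :=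
    norm_eq_of_norm_sub_lt_right (by rwa [norm_sub_rev])
  have hconj : ∀ r ∈ s, ‖r - algebraMap _ _ (c + d)‖ < ‖y‖ := fun r hr => by
    have hr' : aeval r (minpoly ℚ_[p] x) = 0 := by
      rw [hs] at hr
      exact (mem_aroots.1 hr).2
    obtain ⟨σ, rfl⟩ : ∃ σ : PadicAlgCl p ≃ₐ[ℚ_[p] ] PadicAlgCl p, σ x = r := by
      have := minpoly.eq_of_root (Algebra.IsAlgebraic.isAlgebraic x) hr'
      exact (Normal.minpoly_eq_iff_mem_orbit _).1 this
    rw [← σ.commutes, ← map_sub, norm_algEquiv, map_add, ← sub_sub]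
    exact hd
  have hlt := norm_multiset_sum_lt (norm_pos_iff.2 h0) s _ hconj
  have hcardK : (s.card : PadicAlgCl p) ≠ 0 := by exact_mod_cast hcard
  have hval : (s.map fun r => r - algebraMap _ _ (c + d)).sum
      = -((s.card : PadicAlgCl p) * algebraMap _ _ d) := by
    rw [Multiset.sum_map_sub, Multiset.map_id', Multiset.map_const', Multiset.sum_replicate,
      map_add, hc, nsmul_eq_mul]
    field_simp
    ring
  rw [hval, norm_neg, norm_mul, norm_natCast_eq_one hcard hp, one_mul, hnd] at hlt
  exact lt_irrefl _ hlt

/-- If an integer polynomial splits modulo `p`, then every unit that is a root of its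
reduction is congruent to an integer. -/
theorem exists_norm_sub_intCast_lt_one {G : ℤ[X]} (h0 : G.map (Int.castRingHom (ZMod p)) ≠ 0)
    (hG : (G.map (Int.castRingHom (ZMod p))).Splits) {z : PadicAlgCl p} (hz : ‖z‖ ≤ 1)
    (hGz : ‖aeval z G‖ < 1) : ∃ r : ℤ, ‖z - r‖ < 1 := by
  obtain ⟨a, ha⟩ := ZMod.intCast_surjective (G.map (Int.castRingHom (ZMod p))).leadingCoeff
  let s : Multiset ℤ := (G.map (Int.castRingHom (ZMod p))).roots.map fun r => (r.val : ℤ)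
  have hmap : (G - C a * (s.map fun r => X - C r).prod).map (Int.castRingHom (ZMod p)) = 0 := by
    rw [Polynomial.map_sub, sub_eq_zero]
    conv_lhs => rw [hG.eq_prod_roots]
    rw [Polynomial.map_mul, map_C, eq_intCast, ha, Polynomial.map_multiset_prod,
      Multiset.map_map, Multiset.map_map]
    congr 2
    refine Multiset.map_congr rfl fun r _ => ?_
    rw [Function.comp_apply, Function.comp_apply, Polynomial.map_sub, map_X, map_C, eq_intCast,
      Int.cast_natCast, ZMod.natCast_zmod_val]
  have hp0 : ‖(p : PadicAlgCl p)‖ < 1 := by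
    rw [← map_natCast (algebraMap ℚ_[p] (PadicAlgCl p)), norm_algebraMap]
    exact Padic.norm_p_lt_one
  have hle : ∀ H : ℤ[X], ‖aeval z H‖ ≤ 1 := fun H => by
    induction H using Polynomial.induction_on' with
    | add f g hf hg =>
      rw [map_add]
      exact (isNonarchimedean p _ _).trans (max_le hf hg)
    | monomial n k =>
      rw [aeval_monomial, norm_mul, norm_pow, eq_intCast]
      exact mul_le_one₀ (norm_intCast_le_one k) (by positivity) (pow_le_one₀ (by positivity) hz)
  obtain ⟨H, hH⟩ : C (p : ℤ) ∣ G - C a * (s.map fun r => X - C r).prod :=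
    C_dvd_iff_dvd_coeff _ _ |>.2 fun i => by
      have := congrArg (fun q => q.coeff i) hmap
      simpa only [coeff_map, eq_intCast, coeff_zero, ZMod.intCast_zmod_eq_zero_iff_dvd] using this
  have hprod : ‖aeval z (C a * (s.map fun r => X - C r).prod)‖ < 1 := by
    have : aeval z (C a * (s.map fun r => X - C r).prod) = aeval z G - p * aeval z H := by
      rw [eq_sub_iff_add_eq, ← eq_sub_iff_add_eq', ← map_sub, hH]
      simp
    rw [this, sub_eq_add_neg]
    refine (isNonarchimedean p _ _).trans_lt (max_lt hGz ?_)
    rw [norm_neg, norm_mul]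
    exact mul_lt_one_of_nonneg_of_lt_one_left (norm_nonneg _) hp0 (hle H)
  have hpa : ¬ (p : ℤ) ∣ a := fun h => h0 <| by
    rw [← ZMod.intCast_zmod_eq_zero_iff_dvd, ha] at h
    exact leadingCoeff_eq_zero.1 h
  rw [map_mul, aeval_C, eq_intCast, norm_mul, norm_intCast_eq_one hpa, one_mul] at hprod
  by_contra! hcon
  refine hprod.not_ge ?_
  generalize s = s
  induction s using Multiset.induction with
  | empty => simp
  | cons r s ih =>
    rw [Multiset.map_cons, Multiset.prod_cons, map_mul, norm_mul]
    exact one_le_mul_of_one_le_of_one_le (by simpa using hcon r) ih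

/-- `t` is close to a power of `p` whose exponent is nonzero and divisible by all positive
integers up to `p`. -/
def IsNearPower (t : ℚ_[p]) : Prop :=
  ∃ N : ℤ, N ≠ 0 ∧ (∀ n : ℕ, 0 < n → n ≤ p → (n : ℤ) ∣ N) ∧
    ‖t - (p : ℚ_[p]) ^ N‖ < ‖(p : ℚ_[p]) ^ N‖

theorem norm_pow_sub_pow_lt {t q : PadicAlgCl p} (h : ‖t - q‖ < ‖q‖) (n : ℕ) :
    ‖t ^ n - q ^ n‖ < ‖q‖ ^ n := by
  have hq : 0 < ‖q‖ := (norm_nonneg _).trans_lt h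
  have htq : ‖t‖ = ‖q‖ := norm_eq_of_norm_sub_lt_right h
  induction n with
  | zero => simp
  | succ n ih =>
    have : t ^ (n + 1) - q ^ (n + 1) = (t ^ n - q ^ n) * t + q ^ n * (t - q) := by ring
    rw [this]
    refine (isNonarchimedean p _ _).trans_lt (max_lt ?_ ?_)
    · rw [norm_mul, htq, pow_succ]
      gcongr
    · rw [norm_mul, norm_pow, pow_succ]
      gcongr

/-- A nonzero root of a bivariate integer polynomial specialised at an element close to a
suitable power of `p` is approximated by an element of `ℚ_[p]`, provided that finitely many
auxiliary integer polynomials split modulo `p`. -/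
theorem exists_norm_sub_lt_of_sum_eq_zero {A : Finset ((_ : ℕ) × ℕ)} {a : (_ : ℕ) × ℕ → ℤ}
    (hne : A.Nonempty) (ha : ∀ k ∈ A, ¬ (p : ℤ) ∣ a k) (hdeg : ∀ k ∈ A, k.1 ≤ p)
    (hG : ∀ S ⊆ A, ((∑ k ∈ S, C (a k) * X ^ k.1).map (Int.castRingHom (ZMod p))).Splits)
    {t : ℚ_[p]} (ht : IsNearPower t) {y : PadicAlgCl p} (hy : y ≠ 0)
    (h : ∑ k ∈ A, (a k : PadicAlgCl p) * algebraMap _ _ t ^ k.2 * y ^ k.1 = 0) :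
    ∃ d : ℚ_[p], ‖y - algebraMap _ _ d‖ < ‖y‖ := by
  obtain ⟨N, hN0, hN, hlt⟩ := ht
  set P : PadicAlgCl p := algebraMap ℚ_[p] _ (p : ℚ_[p]) with hP
  set T : PadicAlgCl p := algebraMap ℚ_[p] _ t
  have hp1 : ‖P‖ < 1 := by rw [hP, norm_algebraMap]; exact Padic.norm_p_lt_one
  have hP0 : P ≠ 0 := by simp [hP, (Fact.out : p.Prime).ne_zero]
  have hPpos : 0 < ‖P‖ := norm_pos_iff.2 hP0
  have hzinj : Function.Injective fun n : ℤ => ‖P‖ ^ n := zpow_right_injective₀ hPpos hp1.ne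
  set Q : PadicAlgCl p := P ^ N with hQ
  have hTQ : ‖T - Q‖ < ‖Q‖ := by
    rwa [hQ, hP, ← map_zpow₀, ← map_sub, norm_algebraMap, norm_algebraMap]
  have hQpos : 0 < ‖Q‖ := (norm_nonneg _).trans_lt hTQ
  have hQ1 : ‖Q‖ ≠ 1 := fun h1 => hN0 <| hzinj <| by simpa [hQ] using h1
  have hypos : 0 < ‖y‖ := norm_pos_iff.2 hy
  have hTQn : ‖T‖ = ‖Q‖ := norm_eq_of_norm_sub_lt_right hTQ
  set w : (_ : ℕ) × ℕ → ℝ := fun k => ‖Q‖ ^ k.2 * ‖y‖ ^ k.1 with hw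
  have hwpos : ∀ k, 0 < w k := fun k => by positivity
  obtain ⟨k₀, hk₀, hmax⟩ := A.exists_max_image w hne
  set S := A.filter fun k => w k = w k₀ with hS
  have hSA : S ⊆ A := Finset.filter_subset _ _
  have hk₀S : k₀ ∈ S := Finset.mem_filter.2 ⟨hk₀, rfl⟩
  have hSw : ∀ k ∈ S, w k = w k₀ := fun k hk => (Finset.mem_filter.1 hk).2
  have hsum : ‖∑ k ∈ S, (a k : PadicAlgCl p) * Q ^ k.2 * y ^ k.1‖ < w k₀ := by
    have h1 : ∑ k ∈ S, (a k : PadicAlgCl p) * Q ^ k.2 * y ^ k.1 =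
        ∑ k ∈ A, (a k : PadicAlgCl p) *
          ((if w k = w k₀ then Q ^ k.2 else 0) - T ^ k.2) * y ^ k.1 := by
      refine (sub_zero _).symm.trans ?_
      conv_lhs => rw [← h, hS, Finset.sum_filter, ← Finset.sum_sub_distrib]
      refine Finset.sum_congr rfl fun k _ => ?_
      split_ifs <;> ring
    rw [h1]
    refine norm_multiset_sum_lt (hwpos k₀) A.val _ fun k hk => ?_
    rw [norm_mul, norm_mul, norm_pow, mul_assoc]
    refine (mul_le_of_le_one_left (by positivity) (norm_intCast_le_one _)).trans_lt ?_
    split_ifs with hwk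
    · rw [← hwk, norm_sub_rev]
      exact mul_lt_mul_of_pos_right (norm_pow_sub_pow_lt hTQ _) (by positivity)
    · rw [zero_sub, norm_neg, norm_pow, hTQn]
      exact (hmax k hk).lt_of_ne hwk
  have hinj : ∀ k ∈ S, ∀ k' ∈ S, k.1 = k'.1 → k = k' := fun k hk k' hk' hkk => by
    have h1 : w k = w k' := (hSw k hk).trans (hSw k' hk').symm
    simp only [hw, hkk] at h1
    have h2 := pow_right_injective₀ hQpos hQ1 (mul_right_cancel₀ (by positivity) h1)
    exact Sigma.ext hkk (heq_of_eq h2)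
  obtain ⟨k₁, hk₁, hk₁₀⟩ : ∃ k₁ ∈ S, k₁ ≠ k₀ := by
    by_contra! hcon
    have : S = {k₀} := Finset.eq_singleton_iff_unique_mem.2 ⟨hk₀S, hcon⟩
    rw [this, Finset.sum_singleton, norm_mul, norm_mul, norm_intCast_eq_one (ha k₀ hk₀), norm_pow,
      norm_pow, one_mul] at hsum
    exact lt_irrefl _ hsum
  have hj : k₁.1 ≠ k₀.1 := fun hj => hk₁₀ (hinj _ hk₁ _ hk₀S hj)
  obtain ⟨c, hc⟩ : ((k₁.1 : ℤ) - k₀.1) ∣ N := by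
    have h1 := hdeg k₁ (hSA hk₁)
    have h2 := hdeg k₀ hk₀
    rw [← Int.natAbs_dvd]
    exact hN _ (by omega) (by omega)
  obtain ⟨r, hr⟩ : ∃ r : ℤ, ‖y‖ = ‖P‖ ^ r := by
    refine ⟨c * (k₀.2 - k₁.2), ?_⟩
    have h1 : ‖Q‖ ^ k₁.2 * ‖y‖ ^ k₁.1 = ‖Q‖ ^ k₀.2 * ‖y‖ ^ k₀.1 := hSw k₁ hk₁
    have h2 : ‖y‖ ^ ((k₁.1 : ℤ) - k₀.1) =
        (‖P‖ ^ (c * ((k₀.2 : ℤ) - k₁.2))) ^ ((k₁.1 : ℤ) - k₀.1) := by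
      rw [← zpow_mul, mul_right_comm, mul_comm c, ← hc, zpow_mul, ← norm_zpow P, ← hQ,
        zpow_sub₀ hypos.ne', zpow_sub₀ hQpos.ne', div_eq_div_iff (by positivity) (by positivity)]
      simp only [zpow_natCast]
      linarith
    exact (zpow_left_inj₀ hypos.le (by positivity) (by omega)).1 h2
  set π : PadicAlgCl p := P ^ r with hπ
  have hπ0 : π ≠ 0 := zpow_ne_zero _ hP0
  obtain ⟨z, rfl⟩ : ∃ z, y = π * z := ⟨y / π, by field_simp⟩
  have hz : ‖z‖ = 1 := by
    rw [norm_mul, hπ, norm_zpow] at hr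
    exact mul_eq_left₀ (zpow_ne_zero _ hPpos.ne') |>.1 hr
  have hwz : ∀ k, w k = ‖P‖ ^ (N * k.2 + r * k.1) := fun k => by
    rw [hw, zpow_add₀ hPpos.ne', zpow_mul, zpow_mul]
    simp [hz, hQ, hπ]
  have hexp : ∀ k ∈ S, Q ^ k.2 * π ^ k.1 = P ^ (N * k₀.2 + r * k₀.1) := fun k hk => by
    have h1 := hSw k hk
    rw [hwz, hwz] at h1
    rw [← hzinj h1, zpow_add₀ hP0, zpow_mul, zpow_mul]
    simp [hQ, hπ]
  have hGz : ‖aeval z (∑ k ∈ S, C (a k) * X ^ k.1)‖ < 1 := by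
    have h1 : ∑ k ∈ S, (a k : PadicAlgCl p) * Q ^ k.2 * (π * z) ^ k.1 =
        P ^ (N * k₀.2 + r * k₀.1) * aeval z (∑ k ∈ S, C (a k) * X ^ k.1) := by
      rw [map_sum, Finset.mul_sum]
      refine Finset.sum_congr rfl fun k hk => ?_
      rw [← hexp k hk]
      rw [map_mul, map_pow, aeval_C, aeval_X, eq_intCast]
      ring
    rw [h1, norm_mul, norm_zpow, ← hwz] at hsum
    exact (mul_lt_iff_lt_one_right (hwpos k₀)).1 hsum
  have hG0 : (∑ k ∈ S, C (a k) * X ^ k.1).map (Int.castRingHom (ZMod p)) ≠ 0 := fun h0 => by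
    have h1 := congrArg (fun q => q.coeff k₀.1) h0
    simp only [coeff_map, finsetSum_coeff, coeff_C_mul, coeff_X_pow, coeff_zero] at h1
    rw [Finset.sum_eq_single k₀ (fun k hk hkk => by
      rw [if_neg fun hj => hkk (hinj k hk k₀ hk₀S hj.symm), mul_zero]) (fun hk => (hk hk₀S).elim),
      if_pos rfl, mul_one, eq_intCast, ZMod.intCast_zmod_eq_zero_iff_dvd] at h1
    exact ha k₀ hk₀ h1
  obtain ⟨n, hn⟩ := exists_norm_sub_intCast_lt_one hG0 (hG S hSA) hz.le hGz
  refine ⟨(p : ℚ_[p]) ^ r * n, ?_⟩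
  rw [map_mul, map_zpow₀, map_intCast, ← hP, ← hπ, ← mul_sub, norm_mul, norm_mul, hz]
  exact mul_lt_mul_of_pos_left hn (norm_pos_iff.2 hπ0)

end PadicAlgCl

open PadicAlgCl

instance Nat.Primes.fact_prime (p : Nat.Primes) : Fact (p : ℕ).Prime := ⟨p.2⟩

/-- The filter on the primes generated by the sets of primes modulo which a given nonzero
integer polynomial splits and stays nonzero. -/
def splittingFilter : Filter Nat.Primes where
  sets := {A | ∃ G : ℤ[X], G ≠ 0 ∧ ∀ p : Nat.Primes, G.map (Int.castRingHom (ZMod p)) ≠ 0 →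
    (G.map (Int.castRingHom (ZMod p))).Splits → p ∈ A}
  univ_sets := ⟨1, one_ne_zero, fun _ _ _ => Set.mem_univ _⟩
  sets_of_superset := fun ⟨G, hG, h⟩ hAB => ⟨G, hG, fun p h0 hs => hAB (h p h0 hs)⟩
  inter_sets := fun ⟨G, hG, hA⟩ ⟨H, hH, hB⟩ => by
    refine ⟨G * H, mul_ne_zero hG hH, fun p h0 hs => ?_⟩
    rw [Polynomial.map_mul] at h0 hs
    exact ⟨hA p (left_ne_zero_of_mul h0) (hs.of_dvd h0 (dvd_mul_right _ _)),
      hB p (right_ne_zero_of_mul h0) (hs.of_dvd h0 (dvd_mul_left _ _))⟩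

namespace splittingFilter

instance neBot : NeBot splittingFilter := by
  refine ⟨fun h => ?_⟩
  obtain ⟨G, hG, hA⟩ := empty_mem_iff_bot.2 h
  obtain ⟨p, hp, h0, hs⟩ := exists_prime_splits_zmod hG
  exact hA ⟨p, hp⟩ h0 hs

theorem eventually_splits (G : ℤ[X]) :
    ∀ᶠ p : Nat.Primes in splittingFilter, (G.map (Int.castRingHom (ZMod p))).Splits := by
  by_cases hG : G = 0
  · simp [hG]
  · exact ⟨G, hG, fun p _ h => h⟩

theorem eventually_not_dvd {m : ℤ} (hm : m ≠ 0) :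
    ∀ᶠ p : Nat.Primes in splittingFilter, ¬ ((p : ℕ) : ℤ) ∣ m := by
  refine ⟨C m, C_ne_zero.2 hm, fun p h0 _ hd => h0 ?_⟩
  rw [map_C, eq_intCast, (ZMod.intCast_zmod_eq_zero_iff_dvd _ _).2 hd, C_0]

theorem eventually_gt (n : ℕ) : ∀ᶠ p : Nat.Primes in splittingFilter, n < p := by
  filter_upwards [eventually_not_dvd (m := n.factorial) (by positivity)] with p hp
  by_contra! h
  exact hp (Int.natCast_dvd_natCast.2 (Nat.dvd_factorial p.2.pos h))

end splittingFilter

section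

variable {Ω : Type*} [Field Ω] [Algebra ℤ[X] Ω]

/-- The embedding `ι` sends the variable to the element `t` of `ℚ_[p]`, which is close to a
suitable power of `p`. -/
def IsAdmissible {p : ℕ} [Fact p.Prime] (ι : Ω →+* PadicAlgCl p) (t : ℚ_[p]) : Prop :=
  IsNearPower t ∧ ι (algebraMap ℤ[X] Ω X) = algebraMap _ _ t

theorem IsAdmissible.comp_algebraMap {p : ℕ} [Fact p.Prime] {ι : Ω →+* PadicAlgCl p}
    {t : ℚ_[p]} (h : IsAdmissible ι t) :
    ι.comp (algebraMap ℤ[X] Ω) =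
      (algebraMap ℚ_[p] (PadicAlgCl p)).comp (aeval t : ℤ[X] →ₐ[ℤ] ℚ_[p]).toRingHom :=
  Polynomial.ringHom_ext (fun n => by simp) (by simpa using h.2)

theorem splittingFilter.eventually_exists_norm_sub_lt [Algebra.IsAlgebraic ℤ[X] Ω] (y : Ω) :
    ∀ᶠ p : Nat.Primes in splittingFilter, ∀ (ι : Ω →+* PadicAlgCl p) (t : ℚ_[p]),
      IsAdmissible ι t → y ≠ 0 → ∃ d : ℚ_[p], ‖ι y - algebraMap _ _ d‖ < ‖ι y‖ := by
  obtain ⟨F, hF, hFy⟩ := Algebra.IsAlgebraic.isAlgebraic (R := ℤ[X]) y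
  let A := F.support.sigma fun j => (F.coeff j).support
  let a : (_ : ℕ) × ℕ → ℤ := fun k => (F.coeff k.1).coeff k.2
  have hA : ∀ k ∈ A, a k ≠ 0 := fun k hk => mem_support_iff.1 (Finset.mem_sigma.1 hk).2
  have hne : A.Nonempty := by
    obtain ⟨j, hj⟩ := nonempty_support_iff.2 hF
    obtain ⟨i, hi⟩ := nonempty_support_iff.2 (mem_support_iff.1 hj)
    exact ⟨⟨j, i⟩, Finset.mem_sigma.2 ⟨hj, hi⟩⟩
  filter_upwards [(eventually_all_finset A).2 fun k hk => eventually_not_dvd (hA k hk),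
    (eventually_all_finset A).2 fun k _ => eventually_gt k.1,
    (eventually_all_finset A.powerset).2 fun S _ =>
      eventually_splits (∑ k ∈ S, C (a k) * X ^ k.1)] with p h1 h2 h3 ι t hι hy
  refine exists_norm_sub_lt_of_sum_eq_zero hne h1 (fun k hk => (h2 k hk).le)
    (fun S hS => h3 S (Finset.mem_powerset.2 hS)) hι.1 ((map_ne_zero ι).2 hy) ?_
  have h4 := congrArg ι hFy
  have h5 (f : ℤ[X]) : ι (algebraMap ℤ[X] Ω f) =
      ∑ i ∈ f.support, (f.coeff i : PadicAlgCl p) * algebraMap _ _ t ^ i := by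
    refine (RingHom.congr_fun hι.comp_algebraMap f).trans ?_
    change algebraMap ℚ_[p] (PadicAlgCl p) (aeval t f) = _
    simp [aeval_def, eval₂_eq_sum, Polynomial.sum]
  rw [aeval_def, eval₂_eq_sum, Polynomial.sum, map_zero, map_sum] at h4
  rw [Finset.sum_sigma, ← h4]
  simp only [map_mul, map_pow, h5, Finset.sum_mul]
  rfl

theorem splittingFilter.eventually_mem_range [IsAlgClosed Ω] [FaithfulSMul ℤ[X] Ω]
    [Algebra.IsAlgebraic ℤ[X] Ω] (x : Ω) :
    ∀ᶠ p : Nat.Primes in splittingFilter, ∀ (ι : Ω →+* PadicAlgCl p) (t : ℚ_[p]),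
      IsAdmissible ι t → ι x ∈ (algebraMap ℚ_[p] (PadicAlgCl p)).range := by
  classical
  obtain ⟨F, hF, hFx⟩ := Algebra.IsAlgebraic.isAlgebraic (R := ℤ[X]) x
  set g := F.map (algebraMap ℤ[X] Ω) with hg
  have hg0 : g ≠ 0 := (Polynomial.map_ne_zero_iff (FaithfulSMul.algebraMap_injective _ _)).2 hF
  filter_upwards [eventually_gt g.roots.toFinset.card,
    (eventually_all_finset g.roots.toFinset.powerset).2 fun S _ =>
      eventually_exists_norm_sub_lt (x - (∑ r ∈ S, r) / S.card)] with p hp h ι t hι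
  set s := (minpoly ℚ_[p] (ι x)).aroots (PadicAlgCl p) with hs
  have hsroots : ∀ r ∈ s, ∃ r' ∈ g.roots, ι r' = r := fun r hr => by
    have hmap : g.map ι = (F.map (aeval t : ℤ[X] →ₐ[ℤ] ℚ_[p]).toRingHom).map
        (algebraMap ℚ_[p] (PadicAlgCl p)) := by
      rw [hg, Polynomial.map_map, Polynomial.map_map, hι.comp_algebraMap]
    have hdvd : minpoly ℚ_[p] (ι x) ∣ F.map (aeval t : ℤ[X] →ₐ[ℤ] ℚ_[p]).toRingHom := by
      refine minpoly.dvd _ _ ?_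
      rw [aeval_def, ← eval_map, ← hmap, eval_map, eval₂_at_apply, hg, eval_map_algebraMap, hFx,
        map_zero]
    have hr' : r ∈ (g.map ι).roots := by
      rw [hmap]
      refine Multiset.mem_of_le (roots.le_of_dvd ?_ (Polynomial.map_dvd _ hdvd)) hr
      rw [← hmap]
      exact (Polynomial.map_ne_zero_iff ι.injective).2 hg0
    rwa [(IsAlgClosed.splits g).roots_map, Multiset.mem_map] at hr'
  set S := g.roots.toFinset.filter fun r => ι r ∈ s with hS
  have hsnodup : s.Nodup := nodup_roots <|
    (minpoly.irreducible (Algebra.IsIntegral.isIntegral (ι x))).separable.map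
  have hsS : s = S.val.map ι := by
    refine (hsnodup.ext (S.nodup.map ι.injective)).2 fun r => ?_
    rw [Multiset.mem_map]
    constructor
    · intro hr
      obtain ⟨r', hr', rfl⟩ := hsroots r hr
      exact ⟨r', Finset.mem_filter.2 ⟨Multiset.mem_toFinset.2 hr', hr⟩, rfl⟩
    · rintro ⟨r', hr', rfl⟩
      exact (Finset.mem_filter.1 hr').2
  have havg : ι x - s.sum / s.card = ι (x - (∑ r ∈ S, r) / S.card) := by
    simp [hsS, map_sum]
  refine mem_range_of_norm_sub_lt hs ?_ fun h0 => ?_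
  · rw [hsS, Multiset.card_map]
    exact (Finset.card_le_card (Finset.filter_subset _ _)).trans_lt hp
  · rw [havg] at h0 ⊢
    exact h S (Finset.mem_powerset.2 (Finset.filter_subset _ _)) ι t hι ((map_ne_zero ι).1 h0)

end

theorem IsExistentialBlock.isExistential {L : Language} {α : Type*} {n : ℕ}
    {φ : L.BoundedFormula α n} (hφ : IsExistentialBlock φ) : φ.IsExistential := by
  induction hφ with
  | of_isQF h => exact .of_isQF h
  | ex _ ih => exact .ex ih

section

variable {Ω : Type*} [Field Ω] [Algebra ℤ[X] Ω]

/-- An element close to `p ^ N` can be chosen transcendental, and is then the image of the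
variable under an embedding. -/
theorem exists_isAdmissible (Ω : Type*) [Field Ω] [Algebra ℤ[X] Ω] [FaithfulSMul ℤ[X] Ω]
    [Algebra.IsAlgebraic ℤ[X] Ω] {p : ℕ} [Fact p.Prime] {N : ℤ} (hN0 : N ≠ 0)
    (hN : ∀ n : ℕ, 0 < n → n ≤ p → (n : ℤ) ∣ N) :
    ∃ (ι : Ω →+* PadicAlgCl p) (t : ℚ_[p]), IsAdmissible ι t ∧ ‖t‖ = ‖(p : ℚ_[p]) ^ N‖ := by
  have hpos : 0 < ‖(p : ℚ_[p]) ^ N‖ :=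
    norm_pos_iff.2 (zpow_ne_zero _ (by exact_mod_cast (Fact.out : p.Prime).ne_zero))
  obtain ⟨t, ht, htN⟩ := ((Algebraic.countable ℤ ℚ_[p]).dense_compl ℚ_[p]).exists_dist_lt
    ((p : ℚ_[p]) ^ N) hpos
  rw [dist_eq_norm, norm_sub_rev] at htN
  have hinj : Function.Injective ((algebraMap ℚ_[p] (PadicAlgCl p)).comp
      (aeval t : ℤ[X] →ₐ[ℤ] ℚ_[p]).toRingHom) :=
    (algebraMap ℚ_[p] (PadicAlgCl p)).injective.comp (transcendental_iff_injective.1 ht)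
  let : Algebra ℤ[X] (PadicAlgCl p) := ((algebraMap ℚ_[p] (PadicAlgCl p)).comp
    (aeval t : ℤ[X] →ₐ[ℤ] ℚ_[p]).toRingHom).toAlgebra
  have : FaithfulSMul ℤ[X] (PadicAlgCl p) := (faithfulSMul_iff_algebraMap_injective _ _).2 hinj
  let f : Ω →ₐ[ℤ[X]] PadicAlgCl p := IsAlgClosed.lift
  refine ⟨f, t, ⟨⟨N, hN0, hN, htN⟩, (f.commutes X).trans ?_⟩,
    Padic.norm_eq_of_norm_sub_lt_right htN⟩
  change algebraMap ℚ_[p] (PadicAlgCl p) (aeval t X) = _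
  rw [aeval_X]

/-- Existential formulas true in `Ω` are true in `ℚ_[p]`, for `p` large along
`splittingFilter`, at the tuples corresponding under admissible embeddings. -/
theorem FirstOrder.Language.BoundedFormula.IsExistential.eventually_realize [IsAlgClosed Ω]
    [FaithfulSMul ℤ[X] Ω] [Algebra.IsAlgebraic ℤ[X] Ω] {α : Type*} {n : ℕ}
    {φ : Language.ring.BoundedFormula α n} (hφ : φ.IsExistential) {v : α → Ω} {xs : Fin n → Ω}
    (h : φ.Realize v xs) :
    ∀ᶠ p : Nat.Primes in splittingFilter, ∀ (ι : Ω →+* PadicAlgCl p) (t : ℚ_[p]),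
      IsAdmissible ι t → ∀ (v' : α → ℚ_[p]) (xs' : Fin n → ℚ_[p]),
        algebraMap _ _ ∘ v' = ι ∘ v → algebraMap _ _ ∘ xs' = ι ∘ xs → φ.Realize v' xs' := by
  induction hφ with
  | @of_isQF n φ hφ =>
    refine Eventually.of_forall fun p ι t _ v' xs' hv hxs => ?_
    have h1 := (hφ.realize_embedding (Ring.languageEmbeddingOfRingHom ι ι.injective)).2 h
    refine (hφ.realize_embedding (Ring.languageEmbeddingOfRingHom
      (algebraMap ℚ_[p] (PadicAlgCl p)) (algebraMap ℚ_[p] (PadicAlgCl p)).injective)).1 ?_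
    change φ.Realize (algebraMap ℚ_[p] (PadicAlgCl p) ∘ v') (algebraMap ℚ_[p] (PadicAlgCl p) ∘ xs')
    rw [hv, hxs]
    exact h1
  | ex _ ih =>
    obtain ⟨x, hx⟩ := BoundedFormula.realize_ex.1 h
    filter_upwards [ih hx, splittingFilter.eventually_mem_range x] with
      p hp hmem ι t hι v' xs' hv hxs
    obtain ⟨x', hx'⟩ := hmem ι t hι
    refine BoundedFormula.realize_ex.2 ⟨x', hp ι t hι v' _ hv ?_⟩
    rw [Fin.comp_snoc, Fin.comp_snoc, hxs, hx']

end

/-- If an existential formula is satisfied in one `ℚ_[q]` by all elements of valuation `M * q!`,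
then, for every `N ≠ 0` and eventually along `splittingFilter`, it is satisfied in `ℚ_[p]` by
some element of valuation `N * p!`. -/
theorem IsExistentialBlock.eventually_exists_realize {θ : Language.ring.Formula (Fin 1)}
    (hθ : IsExistentialBlock θ) {q : Nat.Primes} {M : ℤ} (hM : M ≠ 0)
    (h : ∀ t : ℚ_[q], ‖t‖ = ‖(q : ℚ_[q]) ^ (M * (q : ℕ).factorial)‖ → θ.Realize fun _ => t)
    {N : ℤ} (hN : N ≠ 0) :
    ∀ᶠ p : Nat.Primes in splittingFilter, ∃ t : ℚ_[p],
      ‖t‖ = ‖(p : ℚ_[p]) ^ (N * (p : ℕ).factorial)‖ ∧ θ.Realize fun _ => t := by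
  let Ω := AlgebraicClosure (FractionRing ℤ[X])
  have : Algebra.IsAlgebraic ℤ[X] Ω :=
    (IsFractionRing.comap_isAlgebraic_iff (K := FractionRing ℤ[X])).2 inferInstance
  have : FaithfulSMul ℤ[X] Ω := (faithfulSMul_iff_algebraMap_injective _ _).2 <| by
    rw [IsScalarTower.algebraMap_eq ℤ[X] (FractionRing ℤ[X]) Ω]
    exact (algebraMap (FractionRing ℤ[X]) Ω).injective.comp (IsFractionRing.injective _ _)
  have key (p : Nat.Primes) {N : ℤ} (hN : N ≠ 0) :=
    exists_isAdmissible Ω (p := p) (N := N * (p : ℕ).factorial) (by positivity)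
      fun n h0 hn => (Int.natCast_dvd_natCast.2 (Nat.dvd_factorial h0 hn)).mul_left _
  obtain ⟨ι, t, hι, ht⟩ := key q hM
  let := ι.toAlgebra
  let T : Fin 1 → Ω := fun _ => algebraMap ℤ[X] Ω X
  have hreal := hθ.isExistential.realize_embedding (Ring.languageEmbeddingOfRingHom
    (algebraMap ℚ_[q] (PadicAlgCl q)) (algebraMap ℚ_[q] (PadicAlgCl q)).injective) (h t ht)
  have hT : (Ring.languageEmbeddingOfRingHom (algebraMap ℚ_[q] (PadicAlgCl q))
      (algebraMap ℚ_[q] (PadicAlgCl q)).injective ∘ fun _ => t) =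
        algebraMap Ω (PadicAlgCl q) ∘ T :=
    funext fun _ => hι.2.symm
  rw [hT] at hreal
  obtain ⟨xs, hxs⟩ := hθ.exists_realize_of_isAlgClosed T hreal
  filter_upwards [hθ.isExistential.eventually_realize hxs] with p hp
  obtain ⟨ι', t', hι', ht'⟩ := key p hN
  exact ⟨t', ht', hp ι' t' hι' _ _ (funext fun _ => hι'.2.symm) (Subsingleton.elim _ _)⟩

/-- A property of primes with finitely many exceptions holds along `splittingFilter`. -/
theorem splittingFilter.eventually_of_finite {P : ℕ → Prop}
    (h : {p : ℕ | p.Prime ∧ ¬ P p}.Finite) : ∀ᶠ p : Nat.Primes in splittingFilter, P p := by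
  obtain ⟨n, hn⟩ := h.bddAbove
  filter_upwards [eventually_gt n] with p hp
  by_contra hP
  exact hp.not_ge (hn ⟨p.2, hP⟩)

theorem Padic.norm_p_zpow_mul_factorial_le_one_iff {p : ℕ} [Fact p.Prime] {N : ℤ} :
    ‖(p : ℚ_[p]) ^ (N * p.factorial)‖ ≤ 1 ↔ 0 ≤ N := by
  rw [Padic.norm_p_zpow, zpow_le_one_iff_right₀ (by exact_mod_cast (Fact.out : p.Prime).one_lt),
    neg_nonpos, mul_nonneg_iff_of_pos_right (by positivity)]

end

/-- There is no existential formula of the language of rings defining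
`ℤ_p` in `ℚ_p` for all but finitely many primes `p`, and likewise no universal formula
with this property. -/
theorem no_existential_or_universal_formula_defines_Zp :
    (¬ ∃ φ : Language.ring.Formula (Fin 1), IsExistentialBlock φ ∧
      {p : ℕ | p.Prime ∧ ¬ DefinesZp φ p}.Finite) ∧
    (¬ ∃ φ : Language.ring.Formula (Fin 1), IsUniversalBlock φ ∧
      {p : ℕ | p.Prime ∧ ¬ DefinesZp φ p}.Finite) := by
  constructor
  · rintro ⟨φ, hφ, hfin⟩
    have hdef := splittingFilter.eventually_of_finite hfin
    obtain ⟨q, hq⟩ := hdef.exists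
    obtain ⟨p, hp, t, ht, hreal⟩ := (hdef.and <| hφ.eventually_exists_realize
      (q := q) (M := 1) one_ne_zero (fun t ht => (hq q.fact_prime t).2 <| by
        rw [ht, Padic.norm_p_zpow_mul_factorial_le_one_iff]; simp)
      (N := -1) (by simp)).exists
    have := (hp p.fact_prime t).1 hreal
    rw [ht, Padic.norm_p_zpow_mul_factorial_le_one_iff] at this
    simp at this
  · rintro ⟨φ, hφ, hfin⟩
    have hdef := splittingFilter.eventually_of_finite hfin
    obtain ⟨ψ, hψ, hnot⟩ := hφ.exists_existential_not
    obtain ⟨q, hq⟩ := hdef.exists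
    obtain ⟨p, hp, t, ht, hreal⟩ := (hdef.and <| IsExistentialBlock.eventually_exists_realize hψ
      (q := q) (M := -1) (by simp) (fun t ht => (hnot _ _ _).2 fun hr => by
        have := (hq q.fact_prime t).1 hr
        rw [ht, Padic.norm_p_zpow_mul_factorial_le_one_iff] at this
        simp at this)
      (N := 1) one_ne_zero).exists
    refine (hnot _ _ _).1 hreal ((hp p.fact_prime t).2 ?_)
    rw [ht, Padic.norm_p_zpow_mul_factorial_le_one_iff]
    simp
end
end

section
/- Let L be a one-sorted first-order language, s ≥ 1, and let M₁, …, M_s be L-structures. Equip the Cartesian product M = M₁ × ⋯ × M_s with the product L-structure, in which function symbols are interpreted coordinatewise and a relation symbol holds of a tuple if and only if it holds in every coordinate. Then every subset A ⊆ M that is definable without parameters in the product structure is a finite union of rectangles B₁ × ⋯ × B_s, where each Bᵢ is a subset of Mᵢ definable without parameters in Mᵢ. -/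
open FirstOrder FirstOrder.Language

noncomputable section

/-- The product `L`-structure on a (finite) product of `L`-structures: function symbols
are interpreted coordinatewise and a relation symbol holds of a tuple iff it holds in
every coordinate. -/
def piStructure {L : Language} {ι : Type*} (M : ι → Type*) [∀ i, L.Structure (M i)] :
    L.Structure (∀ i, M i) where
  funMap f x i := Structure.funMap f fun j => x j i
  RelMap r x := ∀ i, Structure.RelMap r fun j => x j i

attribute [local instance] piStructure

namespace FirstOrder.Language.BoundedFormula

open Classical in
/-- The formula saying that each `ψ k` has the truth value `τ k`. -/
def truthPattern {L : Language} {α κ : Type*} [Finite κ] {n : ℕ}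
    (ψ : κ → L.BoundedFormula α n) (τ : κ → Prop) : L.BoundedFormula α n :=
  iInf fun k => if τ k then ψ k else (ψ k).not

theorem realize_truthPattern {L : Language} {α κ N : Type*} [Finite κ] [L.Structure N] {n : ℕ}
    (ψ : κ → L.BoundedFormula α n) (τ : κ → Prop) (v : α → N) (xs : Fin n → N) :
    (truthPattern ψ τ).Realize v xs ↔ (fun k => (ψ k).Realize v xs) = τ := by
  rw [truthPattern, realize_iInf, funext_iff]
  refine forall_congr' fun k => ?_
  by_cases h : τ k <;> simp [h]

end FirstOrder.Language.BoundedFormula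

theorem realize_term_piStructure {L : Language} {ι α : Type*} {M : ι → Type*}
    [∀ i, L.Structure (M i)] (t : L.Term α) (v : α → ∀ i, M i) (i : ι) :
    t.realize v i = t.realize fun a => v a i := by
  induction t with
  | var => rfl
  | func f ts ih =>
    simp only [Term.realize_func, ← ih]
    rfl

theorem realize_boundedTerm_piStructure {L : Language} {ι α : Type*} {M : ι → Type*}
    [∀ i, L.Structure (M i)] {n : ℕ} (t : L.Term (α ⊕ Fin n)) (v : α → ∀ i, M i)
    (xs : Fin n → ∀ i, M i) (i : ι) :
    t.realize (Sum.elim v xs) i =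
      t.realize (Sum.elim (fun a => v a i) fun j => xs j i) := by
  rw [realize_term_piStructure]
  congr 1
  ext (a | j) <;> rfl

/-- A weak Feferman–Vaught theorem: the truth of a formula in a product structure is determined
by the truth values of finitely many formulas in the factors. -/
theorem exists_realize_piStructure_iff {L : Language} {ι α : Type*} {M : ι → Type*}
    [∀ i, L.Structure (M i)] {n : ℕ} (φ : L.BoundedFormula α n) :
    ∃ (κ : Type) (_ : Finite κ) (ψ : κ → L.BoundedFormula α n) (T : Set (ι → κ → Prop)),
      ∀ (v : α → ∀ i, M i) (xs : Fin n → ∀ i, M i), φ.Realize v xs ↔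
        (fun i k => (ψ k).Realize (fun a => v a i) fun j => xs j i) ∈ T := by
  induction φ with
  | falsum => exact ⟨Empty, inferInstance, Empty.elim, ∅, fun v xs => Iff.rfl⟩
  | equal t₁ t₂ =>
    refine ⟨Unit, inferInstance, fun _ => .equal t₁ t₂, {p | ∀ i, p i ()}, fun v xs => ?_⟩
    simp only [BoundedFormula.Realize, Set.mem_ofPred_eq, ← realize_boundedTerm_piStructure]
    exact funext_iff
  | rel R ts =>
    refine ⟨Unit, inferInstance, fun _ => .rel R ts, {p | ∀ i, p i ()}, fun v xs => ?_⟩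
    simp only [BoundedFormula.Realize, Set.mem_ofPred_eq, ← realize_boundedTerm_piStructure]
    rfl
  | imp φ₁ φ₂ ih₁ ih₂ =>
    obtain ⟨κ₁, _, ψ₁, T₁, h₁⟩ := ih₁
    obtain ⟨κ₂, _, ψ₂, T₂, h₂⟩ := ih₂
    refine ⟨κ₁ ⊕ κ₂, inferInstance, Sum.elim ψ₁ ψ₂,
      {p | (fun i k => p i (.inl k)) ∈ T₁ → (fun i k => p i (.inr k)) ∈ T₂}, fun v xs => ?_⟩
    rw [BoundedFormula.realize_imp, h₁, h₂]
    rfl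
  | all φ ih =>
    obtain ⟨κ, _, ψ, T, h⟩ := ih
    refine ⟨κ → Prop, inferInstance, fun τ => (BoundedFormula.truthPattern ψ τ).ex,
      {p | ∀ σ : ι → κ → Prop, (∀ i, p i (σ i)) → σ ∈ T}, fun v xs => ?_⟩
    have snoc_apply (a : ∀ i, M i) (i : ι) :
        (fun j => (Fin.snoc xs a : Fin _ → ∀ i, M i) j i) =
          (Fin.snoc (fun j => xs j i) (a i) : Fin _ → M i) := by
      ext j
      refine Fin.lastCases ?_ (fun j => ?_) j <;> simp
    simp only [BoundedFormula.realize_all, h, snoc_apply, Set.mem_ofPred_eq,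
      BoundedFormula.realize_ex, BoundedFormula.realize_truthPattern]
    constructor
    · intro H σ hσ
      choose a ha using hσ
      rw [← funext ha]
      exact H a
    · exact fun H a => H _ fun i => ⟨a i, rfl⟩

/-- Let `M₁, …, M_s` (`s ≥ 1`) be structures for a one-sorted first-order
language `L`, and equip `M = M₁ × ⋯ × M_s` with the product structure.  Every subset of
`M` definable without parameters in the product structure is a finite union of rectangles
`B₁ × ⋯ × B_s` with each `Bᵢ ⊆ Mᵢ` definable without parameters. -/
theorem definable_subset_of_product_structure_eq_finite_union_of_rectangles
    {L : Language} (s : ℕ) (hs : 1 ≤ s) (M : Fin s → Type*) [∀ i, L.Structure (M i)]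
    (A : Set (∀ i, M i)) (hA : Set.Definable₁ (∅ : Set (∀ i, M i)) L A) :
    ∃ (k : ℕ) (B : Fin k → (i : Fin s) → Set (M i)),
      (∀ (j : Fin k) (i : Fin s), Set.Definable₁ (∅ : Set (M i)) L (B j i)) ∧
      A = ⋃ j : Fin k, {x : ∀ i, M i | ∀ i : Fin s, x i ∈ B j i} := by
  rw [Set.Definable₁, Set.empty_definable_iff] at hA
  obtain ⟨φ, hφ⟩ := hA
  obtain ⟨κ, _, ψ, T, h⟩ := exists_realize_piStructure_iff (M := M) φ
  obtain ⟨k, ⟨e⟩⟩ := Finite.exists_equiv_fin T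
  refine ⟨k, fun j i => {x | (BoundedFormula.truthPattern ψ ((e.symm j).1 i)).Realize
    (fun _ => x) default}, fun j i => ?_, ?_⟩
  · rw [Set.Definable₁, Set.empty_definable_iff]
    refine ⟨BoundedFormula.truthPattern ψ ((e.symm j).1 i), ?_⟩
    ext x
    have hx : (fun _ => x 0) = x := funext fun j => congrArg x (Subsingleton.elim 0 j)
    change BoundedFormula.Realize _ (fun _ => x 0) _ ↔ BoundedFormula.Realize _ x _
    rw [hx]
  · ext x
    have hx : x ∈ A ↔ φ.Realize fun _ => x := Set.ext_iff.mp hφ fun _ => x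
    rw [hx, Formula.Realize, h]
    simp only [Set.mem_iUnion, Set.mem_ofPred_eq, BoundedFormula.realize_truthPattern,
      ← funext_iff, Subsingleton.elim (fun j : Fin 0 => _) default]
    constructor
    · intro hT
      refine ⟨e ⟨_, hT⟩, ?_⟩
      rw [e.symm_apply_apply]
    · rintro ⟨j, hj⟩
      rw [hj]
      exact (e.symm j).2
end
end
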